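/- arXiv:1907.04617 — 3 statements merged into one kernel-verified Lean document; each statement's English description precedes it below -/
import Mathlib

section
/- Let n > 1 and let L be the second order cone in ℝ^n. Every Z-transformation on L is the difference of a Lyapunov-like transformation on L and a matrix mapping L into itself: A ∈ Z(L) if and only if A = B − C where B ∈ ℝ^{n×n} satisfies ⟨Bx,y⟩ = 0 for all x, y ∈ L with ⟨x,y⟩ = 0, and C ∈ ℝ^{n×n} satisfies C(L) ⊆ L. -/
open Matrix

noncomputable section

/-- The second order cone in `ℝⁿ`: `{(t,u) : t ≥ ‖u‖}` (first coordinate is `t`). -/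
def soc (n : ℕ) [NeZero n] : Set (Fin n → ℝ) :=
  {x | Real.sqrt (∑ i, if i = 0 then 0 else (x i) ^ 2) ≤ x 0}

/-- The boundary of the second order cone: `{(t,u) : t = ‖u‖}`. -/
def socBd (n : ℕ) [NeZero n] : Set (Fin n → ℝ) :=
  {x | Real.sqrt (∑ i, if i = 0 then 0 else (x i) ^ 2) = x 0}

/-- `J = diag(1, -1, …, -1)`. -/
def Jmat (n : ℕ) [NeZero n] : Matrix (Fin n) (Fin n) ℝ :=
  Matrix.diagonal (fun i => if i = 0 then 1 else -1)

/-- The dual cone of a set `K ⊆ ℝⁿ`. -/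
def dualCone {n : ℕ} (K : Set (Fin n → ℝ)) : Set (Fin n → ℝ) :=
  {y | ∀ x ∈ K, 0 ≤ x ⬝ᵥ y}

/-- `A` is a Z-transformation on `K`: `x ∈ K`, `y ∈ K*`, `⟨x,y⟩ = 0` imply `⟨Ax,y⟩ ≤ 0`. -/
def IsZTransf {n : ℕ} (K : Set (Fin n → ℝ)) (A : Matrix (Fin n) (Fin n) ℝ) : Prop :=
  ∀ x ∈ K, ∀ y ∈ dualCone K, x ⬝ᵥ y = 0 → (A.mulVec x) ⬝ᵥ y ≤ 0

/-- The completely positive cone of `C`: all finite sums `∑ uᵢuᵢᵀ` with `uᵢ ∈ C`. -/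
def cpCone {n : ℕ} (C : Set (Fin n → ℝ)) : Set (Matrix (Fin n) (Fin n) ℝ) :=
  {X | ∃ (m : ℕ) (u : Fin m → Fin n → ℝ), (∀ i, u i ∈ C) ∧ X = ∑ i, vecMulVec (u i) (u i)}

/-- The copositive cone of `C`: symmetric matrices `A` with `xᵀAx ≥ 0` for all `x ∈ C`. -/
def copCone {n : ℕ} (C : Set (Fin n → ℝ)) : Set (Matrix (Fin n) (Fin n) ℝ) :=
  {A | Aᵀ = A ∧ ∀ x ∈ C, 0 ≤ x ⬝ᵥ A.mulVec x}

/-- `Ω = {(x,y) ∈ L × L : ‖x‖ = 1 = ‖y‖, ⟨x,y⟩ = 0}`. -/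
def OmegaSet (n : ℕ) [NeZero n] : Set ((Fin n → ℝ) × (Fin n → ℝ)) :=
  {p | p.1 ∈ soc n ∧ p.2 ∈ soc n ∧ Real.sqrt (∑ i, p.1 i ^ 2) = 1 ∧
       Real.sqrt (∑ i, p.2 i ^ 2) = 1 ∧ p.1 ⬝ᵥ p.2 = 0}

/-- `γ(A) = max {⟨Ax,y⟩ : (x,y) ∈ Ω}`. -/
def gammaFun (n : ℕ) [NeZero n] (A : Matrix (Fin n) (Fin n) ℝ) : ℝ :=
  sSup {r | ∃ p ∈ OmegaSet n, r = (A.mulVec p.1) ⬝ᵥ p.2}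

/-- **Finsler's lemma**: if `J` is indefinite and `Q` is nonnegative on the null cone of `J`, then
`γ J + Q` is nonnegative for some `γ`. -/
theorem exists_mul_add_nonneg_of_nonneg_on_null {V : Type*} [AddCommGroup V] [Module ℝ V]
    (Q J : LinearMap.BilinForm ℝ V) (hpos : ∃ x, 0 < J x x) (hneg : ∃ y, J y y < 0)
    (h : ∀ z, J z z = 0 → 0 ≤ Q z z) : ∃ γ : ℝ, ∀ x, 0 ≤ γ * J x x + Q x x := by
  have key : ∀ x y, 0 < J x x → J y y < 0 → 0 ≤ -J y y * Q x x + J x x * Q y y := by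
    intro x y hx hy
    set a := J y y with ha
    set b := J x y + J y x with hb
    set c := J x x with hc
    set r := Real.sqrt (b ^ 2 - 4 * a * c) with hr
    have hac : 0 < -(a * c) := by nlinarith
    have hr2 : r ^ 2 = b ^ 2 - 4 * a * c := Real.sq_sqrt (by nlinarith [sq_nonneg b])
    have hrb : |b| < r := Real.lt_sqrt_of_sq_lt (by rw [sq_abs]; linarith)
    obtain ⟨hb1, hb2⟩ := abs_lt.1 hrb
    have expand : ∀ (F : LinearMap.BilinForm ℝ V) (t : ℝ),
        F (x + t • y) (x + t • y) = F x x + t * (F x y + F y x) + t ^ 2 * F y y := by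
      intro F t
      simp only [map_add, map_smul, LinearMap.add_apply, LinearMap.smul_apply, smul_eq_mul]
      ring
    obtain ⟨s, t, hs, ht, hst, hs0, ht0⟩ : ∃ s t : ℝ, s < 0 ∧ 0 < t ∧ a * (s * t) = c ∧
        c + s * b + s ^ 2 * a = 0 ∧ c + t * b + t ^ 2 * a = 0 := by
      refine ⟨(-b + r) / (2 * a), (-b - r) / (2 * a), div_neg_of_pos_of_neg (by linarith)
        (by linarith), div_pos_of_neg_of_neg (by linarith) (by linarith), ?_, ?_, ?_⟩ <;>
      · have := hy.ne
        field_simp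
        linarith [hr2]
    have h1 := h (x + s • y) (by rw [expand]; exact hs0)
    have h2 := h (x + t • y) (by rw [expand]; exact ht0)
    rw [expand] at h1 h2
    have h3 : 0 ≤ (t - s) * (Q x x - s * t * Q y y) := by
      nlinarith [mul_nonneg ht.le h1, mul_nonneg (neg_nonneg.2 hs.le) h2]
    have h4 : 0 ≤ Q x x - s * t * Q y y := nonneg_of_mul_nonneg_right h3 (by linarith)
    have h5 := mul_nonneg (neg_nonneg.2 hy.le) h4
    calc (0 : ℝ) ≤ _ := h5
      _ = _ := by rw [← hst]; ring
  obtain ⟨x₀, hx₀⟩ := hpos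
  obtain ⟨y₀, hy₀⟩ := hneg
  have bound : ∀ x y, 0 < J x x → J y y < 0 → -Q x x / J x x ≤ Q y y / -J y y := by
    intro x y hx hy
    rw [div_le_div_iff₀ hx (by linarith)]
    linarith [key x y hx hy]
  set T : Set ℝ := {r | ∃ x, 0 < J x x ∧ r = -Q x x / J x x} with hT
  have hub : ∀ y, J y y < 0 → Q y y / -J y y ∈ upperBounds T := by
    rintro y hy _ ⟨x, hx, rfl⟩
    exact bound x y hx hy
  refine ⟨sSup T, fun z => ?_⟩
  rcases lt_trichotomy (J z z) 0 with hz | hz | hz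
  · have := csSup_le (s := T) ⟨_, x₀, hx₀, rfl⟩ (hub z hz)
    rw [le_div_iff₀ (by linarith)] at this
    linarith
  · simpa [hz] using h z hz
  · have := le_csSup ⟨_, hub y₀ hy₀⟩ (show -Q z z / J z z ∈ T from ⟨z, hz, rfl⟩)
    rw [div_le_iff₀ hz] at this
    linarith

theorem exists_dotProduct_mulVec_self_le {n : ℕ} (M : Matrix (Fin n) (Fin n) ℝ) :
    ∃ κ : ℝ, 0 ≤ κ ∧ ∀ x, (M *ᵥ x) ⬝ᵥ (M *ᵥ x) ≤ κ * (x ⬝ᵥ x) := by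
  refine ⟨∑ i, ∑ j, M i j ^ 2, by positivity, fun x => ?_⟩
  rw [Finset.sum_mul]
  refine Finset.sum_le_sum fun i _ => ?_
  have := Finset.sum_mul_sq_le_sq_mul_sq Finset.univ (M i) x
  simpa [mulVec, dotProduct, ← sq] using this

open scoped MatrixOrder Matrix.Norms.L2Operator in
theorem exists_dotProduct_mulVec_self_le_of_posSemidef {n : ℕ} {S : Matrix (Fin n) (Fin n) ℝ}
    (hS : S.PosSemidef) :
    ∃ κ : ℝ, 0 ≤ κ ∧ ∀ x, (S *ᵥ x) ⬝ᵥ (S *ᵥ x) ≤ κ * (x ⬝ᵥ S *ᵥ x) := by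
  obtain ⟨T, rfl⟩ := CStarAlgebra.nonneg_iff_eq_star_mul_self.1 hS.nonneg
  obtain ⟨κ, hκ, h⟩ := exists_dotProduct_mulVec_self_le Tᴴ
  refine ⟨κ, hκ, fun x => ?_⟩
  have := h (T *ᵥ x)
  rw [star_eq_conjTranspose]
  rw [conjTranspose_eq_transpose_of_trivial] at *
  rw [← mulVec_mulVec]
  rwa [dotProduct_mulVec x, vecMul_transpose]

theorem dotProduct_eq_zero_add_erase {n : ℕ} [NeZero n] (x y : Fin n → ℝ) :
    x ⬝ᵥ y = x 0 * y 0 + ∑ i ∈ Finset.univ.erase 0, x i * y i :=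
  (Finset.add_sum_erase _ _ (Finset.mem_univ 0)).symm

theorem Jmat_mulVec_apply {n : ℕ} [NeZero n] (x : Fin n → ℝ) (i : Fin n) :
    (Jmat n *ᵥ x) i = if i = 0 then x i else -x i := by
  simp [Jmat, mulVec_diagonal]

theorem Jmat_transpose (n : ℕ) [NeZero n] : (Jmat n)ᵀ = Jmat n := diagonal_transpose _

theorem Jmat_mulVec_Jmat_mulVec {n : ℕ} [NeZero n] (x : Fin n → ℝ) :
    Jmat n *ᵥ Jmat n *ᵥ x = x := by
  ext i
  simp only [Jmat_mulVec_apply]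
  split_ifs <;> simp

theorem dotProduct_Jmat_mulVec_comm {n : ℕ} [NeZero n] (x y : Fin n → ℝ) :
    x ⬝ᵥ Jmat n *ᵥ y = (Jmat n *ᵥ x) ⬝ᵥ y := by
  rw [dotProduct_mulVec, ← mulVec_transpose, Jmat_transpose]

theorem dotProduct_Jmat_mulVec {n : ℕ} [NeZero n] (x y : Fin n → ℝ) :
    x ⬝ᵥ Jmat n *ᵥ y = x 0 * y 0 - ∑ i ∈ Finset.univ.erase 0, x i * y i := by
  rw [dotProduct_eq_zero_add_erase, sub_eq_add_neg, ← Finset.sum_neg_distrib]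
  congr 1
  · simp [Jmat_mulVec_apply]
  · refine Finset.sum_congr rfl fun i hi => ?_
    simp [Jmat_mulVec_apply, Finset.ne_of_mem_erase hi]

theorem dotProduct_Jmat_mulVec_self {n : ℕ} [NeZero n] (x : Fin n → ℝ) :
    x ⬝ᵥ Jmat n *ᵥ x = 2 * x 0 ^ 2 - x ⬝ᵥ x := by
  rw [dotProduct_Jmat_mulVec, dotProduct_eq_zero_add_erase]
  ring

theorem mem_soc_iff_sum_erase {n : ℕ} [NeZero n] (x : Fin n → ℝ) :
    x ∈ soc n ↔ 0 ≤ x 0 ∧ ∑ i ∈ Finset.univ.erase 0, x i * x i ≤ x 0 ^ 2 := by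
  have hsum : (∑ i, if i = 0 then 0 else (x i) ^ 2) = ∑ i ∈ Finset.univ.erase 0, x i * x i := by
    rw [← Finset.add_sum_erase _ _ (Finset.mem_univ (0 : Fin n)), if_pos rfl, zero_add]
    refine Finset.sum_congr rfl fun i hi => ?_
    rw [if_neg (Finset.ne_of_mem_erase hi), sq]
  rw [soc, Set.mem_ofPred_eq, hsum, Real.sqrt_le_iff]

theorem mem_soc_iff {n : ℕ} [NeZero n] (x : Fin n → ℝ) :
    x ∈ soc n ↔ 0 ≤ x 0 ∧ 0 ≤ x ⬝ᵥ Jmat n *ᵥ x := by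
  rw [mem_soc_iff_sum_erase, dotProduct_Jmat_mulVec, sub_nonneg, sq]

theorem Jmat_mulVec_mem_soc {n : ℕ} [NeZero n] {x : Fin n → ℝ} (hx : x ∈ soc n) :
    Jmat n *ᵥ x ∈ soc n := by
  rw [mem_soc_iff] at *
  rw [Jmat_mulVec_Jmat_mulVec, dotProduct_comm]
  exact ⟨by simpa [Jmat_mulVec_apply] using hx.1, hx.2⟩

theorem dualCone_soc (n : ℕ) [NeZero n] : dualCone (soc n) = soc n := by
  ext y
  constructor
  · intro hy
    set w : ℝ := ∑ i ∈ Finset.univ.erase 0, y i * y i with hw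
    have hw0 : 0 ≤ w := Finset.sum_nonneg fun i _ => mul_self_nonneg _
    have hy0 : 0 ≤ y 0 := by
      have := hy (Pi.single 0 1) ((mem_soc_iff _).2
        ⟨by simp, by rw [dotProduct_Jmat_mulVec_self]; norm_num⟩)
      simpa using this
    refine (mem_soc_iff_sum_erase y).2 ⟨hy0, ?_⟩
    have hx : ∀ z : Fin n → ℝ, ∑ i ∈ Finset.univ.erase 0,
        (if i = 0 then Real.sqrt w else -y i) * z i =
        - ∑ i ∈ Finset.univ.erase 0, y i * z i := by
      intro z
      rw [← Finset.sum_neg_distrib]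
      refine Finset.sum_congr rfl fun i hi => ?_
      simp [Finset.ne_of_mem_erase hi]
    have := hy (fun i => if i = 0 then Real.sqrt w else -y i) ((mem_soc_iff_sum_erase _).2
      ⟨by simp, by
        rw [hx, if_pos rfl, Real.sq_sqrt hw0, hw, ← Finset.sum_neg_distrib]
        refine Finset.sum_le_sum fun i hi => ?_
        simp [Finset.ne_of_mem_erase hi]⟩)
    rw [dotProduct_eq_zero_add_erase, hx, if_pos rfl] at this
    have h2 := Real.sq_sqrt hw0
    rcases (Real.sqrt_nonneg w).eq_or_lt with h0 | h0
    · rw [← hw, ← h2, ← h0]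
      simpa using sq_nonneg (y 0)
    · rw [← hw] at this ⊢
      have h3 : Real.sqrt w ≤ y 0 := le_of_mul_le_mul_left (by nlinarith) h0
      rw [← h2]
      gcongr
  · intro hy x hx
    rw [mem_soc_iff_sum_erase] at hx hy
    have h := Finset.sum_mul_sq_le_sq_mul_sq (Finset.univ.erase 0) x y
    simp only [sq (x _), sq (y _)] at h
    rw [dotProduct_eq_zero_add_erase]
    have h1 : (∑ i ∈ Finset.univ.erase 0, x i * y i) ^ 2 ≤ (x 0 * y 0) ^ 2 := by
      rw [mul_pow]
      exact h.trans (mul_le_mul hx.2 hy.2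
        (Finset.sum_nonneg fun i _ => mul_self_nonneg _) (sq_nonneg _))
    have := (abs_le_of_sq_le_sq' h1 (mul_nonneg hx.1 hy.1)).1
    linarith

theorem smul_eq_smul_Jmat_mulVec_of_dotProduct_eq_zero {n : ℕ} [NeZero n] {x y : Fin n → ℝ}
    (hx : x ∈ soc n) (hy : y ∈ soc n) (hxy : x ⬝ᵥ y = 0) :
    x 0 • y = y 0 • Jmat n *ᵥ x := by
  rw [mem_soc_iff_sum_erase] at hx hy
  rw [dotProduct_eq_zero_add_erase] at hxy
  have hsq : ∑ i ∈ Finset.univ.erase 0, (x 0 * y i + y 0 * x i) ^ 2 ≤ 0 := by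
    calc ∑ i ∈ Finset.univ.erase 0, (x 0 * y i + y 0 * x i) ^ 2
        = x 0 ^ 2 * ∑ i ∈ Finset.univ.erase 0, y i * y i +
          2 * (x 0 * y 0) * ∑ i ∈ Finset.univ.erase 0, x i * y i +
          y 0 ^ 2 * ∑ i ∈ Finset.univ.erase 0, x i * x i := by
          simp only [Finset.mul_sum, ← Finset.sum_add_distrib]
          exact Finset.sum_congr rfl fun i _ => by ring
      _ ≤ x 0 ^ 2 * y 0 ^ 2 + 2 * (x 0 * y 0) * (-(x 0 * y 0)) + y 0 ^ 2 * x 0 ^ 2 := by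
          rw [eq_neg_of_add_eq_zero_right hxy]
          gcongr
          exacts [hy.2, hx.2]
      _ = 0 := by ring
  have hz := (Finset.sum_eq_zero_iff_of_nonneg fun i _ => sq_nonneg _).1
    (le_antisymm hsq (Finset.sum_nonneg fun i _ => sq_nonneg _))
  ext i
  simp only [Pi.smul_apply, smul_eq_mul, Jmat_mulVec_apply]
  split_ifs with hi
  · rw [hi]; ring
  · have := pow_eq_zero_iff (two_ne_zero) |>.1 (hz i (by simp [hi]))
    linarith

/-- A matrix `B` for which `J B` is `c J` up to a skew-symmetric matrix is Lyapunov-like on the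
second order cone. -/
theorem mulVec_dotProduct_eq_zero_of_mulVec_dotProduct_Jmat {n : ℕ} [NeZero n]
    {B : Matrix (Fin n) (Fin n) ℝ} {c : ℝ}
    (hB : ∀ x, (B *ᵥ x) ⬝ᵥ Jmat n *ᵥ x = c * (x ⬝ᵥ Jmat n *ᵥ x)) {x y : Fin n → ℝ}
    (hx : x ∈ soc n) (hy : y ∈ soc n) (hxy : x ⬝ᵥ y = 0) : (B *ᵥ x) ⬝ᵥ y = 0 := by
  have hp := smul_eq_smul_Jmat_mulVec_of_dotProduct_eq_zero hx hy hxy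
  rcases eq_or_ne (x 0) 0 with h0 | h0
  · have hxx : x ⬝ᵥ x = 0 := by
      have h1 := ((mem_soc_iff x).1 hx).2
      rw [dotProduct_Jmat_mulVec_self, h0] at h1
      have h2 : 0 ≤ x ⬝ᵥ x := Finset.sum_nonneg fun i _ => mul_self_nonneg _
      linarith
    rw [dotProduct_self_eq_zero.1 hxx, mulVec_zero, zero_dotProduct]
  · refine (mul_eq_zero.1 ?_).resolve_left h0
    calc x 0 * ((B *ᵥ x) ⬝ᵥ y) = (B *ᵥ x) ⬝ᵥ (x 0 • y) := by rw [dotProduct_smul, smul_eq_mul]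
      _ = c * (x ⬝ᵥ (y 0 • Jmat n *ᵥ x)) := by
        rw [hp, dotProduct_smul, dotProduct_smul, hB, smul_eq_mul, smul_eq_mul]; ring
      _ = 0 := by rw [← hp, dotProduct_smul, hxy]; simp

/-- For a positive semidefinite `S` the matrix `ν I + J S` preserves the second order cone once `ν`
is large enough. -/
theorem exists_smul_add_Jmat_mulVec_mem_soc {n : ℕ} [NeZero n] {S : Matrix (Fin n) (Fin n) ℝ}
    (hS : S.PosSemidef) :
    ∃ ν : ℝ, ∀ x ∈ soc n, ν • x + Jmat n *ᵥ S *ᵥ x ∈ soc n := by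
  obtain ⟨κ, hκ, h1⟩ := exists_dotProduct_mulVec_self_le_of_posSemidef hS
  obtain ⟨μ, hμ, h2⟩ := exists_dotProduct_mulVec_self_le S
  refine ⟨κ + 2 * μ + 1, fun x hx => ?_⟩
  have hx' := (mem_soc_iff x).1 hx
  have h1 := h1 x
  have h2 := h2 x
  have hSx : 0 ≤ x ⬝ᵥ S *ᵥ x := by simpa using hS.dotProduct_mulVec_nonneg x
  set w := S *ᵥ x with hw
  set ν := κ + 2 * μ + 1 with hν
  have hw0 : w 0 ^ 2 ≤ w ⬝ᵥ w := by
    rw [dotProduct_eq_zero_add_erase, sq]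
    exact le_add_of_nonneg_right (Finset.sum_nonneg fun i _ => mul_self_nonneg _)
  have hxx : x ⬝ᵥ x ≤ 2 * x 0 ^ 2 := by
    have := hx'.2
    rw [dotProduct_Jmat_mulVec_self] at this
    linarith
  have hwJ : -(w ⬝ᵥ w) ≤ w ⬝ᵥ Jmat n *ᵥ w := by
    rw [dotProduct_Jmat_mulVec_self]
    nlinarith [sq_nonneg (w 0)]
  refine (mem_soc_iff _).2 ⟨?_, ?_⟩
  · have hsq : w 0 ^ 2 ≤ (ν * x 0) ^ 2 := by
      have : 2 * μ ≤ ν ^ 2 := by nlinarith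
      calc w 0 ^ 2 ≤ μ * (2 * x 0 ^ 2) := hw0.trans (h2.trans (by gcongr))
        _ = 2 * μ * x 0 ^ 2 := by ring
        _ ≤ ν ^ 2 * x 0 ^ 2 := by gcongr
        _ = _ := by ring
    have := (abs_le_of_sq_le_sq' hsq (mul_nonneg (by positivity) hx'.1)).1
    simp only [Pi.add_apply, Pi.smul_apply, smul_eq_mul, Jmat_mulVec_apply, if_true]
    linarith
  · have : (ν • x + Jmat n *ᵥ w) ⬝ᵥ Jmat n *ᵥ (ν • x + Jmat n *ᵥ w) =
        ν ^ 2 * (x ⬝ᵥ Jmat n *ᵥ x) + 2 * ν * (x ⬝ᵥ w) + w ⬝ᵥ Jmat n *ᵥ w := by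
      rw [mulVec_add, Jmat_mulVec_Jmat_mulVec, mulVec_smul]
      simp only [add_dotProduct, dotProduct_add, smul_dotProduct, dotProduct_smul, smul_eq_mul]
      rw [← dotProduct_Jmat_mulVec_comm w, ← dotProduct_Jmat_mulVec_comm w,
        Jmat_mulVec_Jmat_mulVec, dotProduct_comm w x]
      ring
    rw [this]
    have h3 : κ * (x ⬝ᵥ w) ≤ 2 * ν * (x ⬝ᵥ w) := by gcongr; linarith
    have h4 : 0 ≤ ν ^ 2 * (x ⬝ᵥ Jmat n *ᵥ x) := mul_nonneg (sq_nonneg _) hx'.2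
    linarith

/-- A Z-transformation on the second order cone has `⟨Ax, Jx⟩ ≤ 0` on the null cone of `J`. -/
theorem IsZTransf.mulVec_dotProduct_Jmat_nonpos {n : ℕ} [NeZero n]
    {A : Matrix (Fin n) (Fin n) ℝ} (hA : IsZTransf (soc n) A) {x : Fin n → ℝ}
    (hx : x ⬝ᵥ Jmat n *ᵥ x = 0) : (A *ᵥ x) ⬝ᵥ Jmat n *ᵥ x ≤ 0 := by
  wlog h0 : 0 ≤ x 0 generalizing x
  · have := @this (-x) (by simpa [mulVec_neg] using hx) (by simp; linarith)
    simpa [mulVec_neg] using this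
  have hmem : x ∈ soc n := (mem_soc_iff x).2 ⟨h0, hx.ge⟩
  exact hA x hmem _ (by rw [dualCone_soc]; exact Jmat_mulVec_mem_soc hmem) hx

theorem exists_mulVec_dotProduct_Jmat_le {n : ℕ} [NeZero n] (hn : 1 < n)
    {A : Matrix (Fin n) (Fin n) ℝ} (hA : IsZTransf (soc n) A) :
    ∃ γ : ℝ, ∀ x, (A *ᵥ x) ⬝ᵥ Jmat n *ᵥ x ≤ γ * (x ⬝ᵥ Jmat n *ᵥ x) := by
  have h10 : (⟨1, hn⟩ : Fin n) ≠ 0 := by simp [Fin.ext_iff]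
  have hQ : ∀ x, Matrix.toBilin' (-(Jmat n * A)) x x = -((A *ᵥ x) ⬝ᵥ Jmat n *ᵥ x) := by
    intro x
    rw [toBilin'_apply', neg_mulVec, dotProduct_neg, ← mulVec_mulVec, dotProduct_Jmat_mulVec_comm,
      dotProduct_comm]
  obtain ⟨γ, hγ⟩ := exists_mul_add_nonneg_of_nonneg_on_null
    (Matrix.toBilin' (-(Jmat n * A))) (Matrix.toBilin' (Jmat n))
    ⟨Pi.single 0 1, by rw [toBilin'_apply', dotProduct_Jmat_mulVec_self]; norm_num⟩
    ⟨Pi.single ⟨1, hn⟩ 1, by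
      rw [toBilin'_apply', dotProduct_Jmat_mulVec_self]; simp [h10.symm]⟩
    (fun z hz => by
      rw [toBilin'_apply'] at hz
      rw [hQ]
      exact neg_nonneg.2 (hA.mulVec_dotProduct_Jmat_nonpos hz))
  refine ⟨γ, fun x => ?_⟩
  have := hγ x
  rw [hQ, toBilin'_apply'] at this
  linarith

theorem dotProduct_half_smul_add_transpose_mulVec {n : ℕ} (M : Matrix (Fin n) (Fin n) ℝ)
    (x : Fin n → ℝ) : x ⬝ᵥ ((2⁻¹ : ℝ) • (M + Mᵀ)) *ᵥ x = x ⬝ᵥ M *ᵥ x := by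
  have : x ⬝ᵥ Mᵀ *ᵥ x = x ⬝ᵥ M *ᵥ x := by
    rw [dotProduct_mulVec, vecMul_transpose, dotProduct_comm]
  rw [smul_mulVec, add_mulVec, dotProduct_smul, dotProduct_add, this, smul_eq_mul]
  ring

theorem stmt15 (n : ℕ) [NeZero n] (hn : 1 < n) (A : Matrix (Fin n) (Fin n) ℝ) :
    IsZTransf (soc n) A ↔
      ∃ B C : Matrix (Fin n) (Fin n) ℝ,
        (∀ x ∈ soc n, ∀ y ∈ soc n, x ⬝ᵥ y = 0 → (B.mulVec x) ⬝ᵥ y = 0) ∧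
        (∀ x ∈ soc n, C.mulVec x ∈ soc n) ∧ A = B - C := by
  constructor
  · intro hA
    obtain ⟨γ, hγ⟩ := exists_mulVec_dotProduct_Jmat_le hn hA
    set M := γ • Jmat n - Jmat n * A with hM
    have hMx : ∀ x, x ⬝ᵥ M *ᵥ x = γ * (x ⬝ᵥ Jmat n *ᵥ x) - (A *ᵥ x) ⬝ᵥ Jmat n *ᵥ x := by
      intro x
      rw [hM, sub_mulVec, dotProduct_sub, smul_mulVec, dotProduct_smul, ← mulVec_mulVec,
        dotProduct_Jmat_mulVec_comm x (A *ᵥ x), dotProduct_comm (A *ᵥ x), smul_eq_mul]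
    set S := (2⁻¹ : ℝ) • (M + Mᵀ) with hS
    have hSx : ∀ x, x ⬝ᵥ S *ᵥ x = γ * (x ⬝ᵥ Jmat n *ᵥ x) - (A *ᵥ x) ⬝ᵥ Jmat n *ᵥ x :=
      fun x => (dotProduct_half_smul_add_transpose_mulVec M x).trans (hMx x)
    have hpsd : S.PosSemidef := by
      refine Matrix.PosSemidef.of_dotProduct_mulVec_nonneg ?_ fun x => ?_
      · rw [IsHermitian, conjTranspose_eq_transpose_of_trivial, hS, transpose_smul, transpose_add,
          transpose_transpose, add_comm]
      · rw [star_trivial, hSx]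
        linarith [hγ x]
    obtain ⟨ν, hν⟩ := exists_smul_add_Jmat_mulVec_mem_soc hpsd
    have hC : ∀ x, (ν • (1 : Matrix (Fin n) (Fin n) ℝ) + Jmat n * S) *ᵥ x =
        ν • x + Jmat n *ᵥ S *ᵥ x := by
      intro x
      rw [add_mulVec, smul_mulVec, one_mulVec, mulVec_mulVec]
    refine ⟨A + (ν • 1 + Jmat n * S), ν • 1 + Jmat n * S, fun x hx y hy hxy => ?_,
      fun x hx => ?_, by simp⟩
    · refine mulVec_dotProduct_eq_zero_of_mulVec_dotProduct_Jmat (c := ν + γ) (fun z => ?_)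
        hx hy hxy
      rw [add_mulVec, hC, add_dotProduct, add_dotProduct, smul_dotProduct,
        ← dotProduct_Jmat_mulVec_comm, Jmat_mulVec_Jmat_mulVec, dotProduct_comm (S *ᵥ z), hSx,
        smul_eq_mul]
      ring
    · rw [hC]
      exact hν x hx
  · rintro ⟨B, C, hB, hC, rfl⟩ x hx y hy hxy
    have h := hy _ (hC x hx)
    rw [dualCone_soc] at hy
    rw [sub_mulVec, sub_dotProduct, hB x hx y hy hxy]
    linarith
end
end

section
/- Let A, B be symmetric n×n real matrices. If there exists x₀ ∈ ℝ^n with x₀ᵀAx₀ > 0, and if for every x ∈ ℝ^n the inequality xᵀAx ≥ 0 implies xᵀBx ≥ 0, then there exists μ ≥ 0 such that B − μA is positive semidefinite. -/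
open Matrix

noncomputable section

/-- Two real quadratics: if `p + c t + q t²` has roots of opposite signs, and `r + d t + s t²` is
nonnegative wherever the former is, then the coefficients satisfy `r q ≤ s p`. -/
theorem mul_le_mul_of_quadratic_nonneg_imp {p c q r d s : ℝ} (hp : 0 < p) (hq : q < 0)
    (h : ∀ t : ℝ, 0 ≤ p + t * c + t ^ 2 * q → 0 ≤ r + t * d + t ^ 2 * s) :
    r * q ≤ s * p := by
  have hpq : p * q < 0 := mul_neg_of_pos_of_neg hp hq
  have hD : 0 ≤ c ^ 2 - 4 * (p * q) := by nlinarith [sq_nonneg c]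
  obtain ⟨D, hD_def⟩ : ∃ D, D = √(c ^ 2 - 4 * (p * q)) := ⟨_, rfl⟩
  have hDsq : D ^ 2 = c ^ 2 - 4 * (p * q) := by rw [hD_def, Real.sq_sqrt hD]
  have hD0 : 0 ≤ D := hD_def ▸ Real.sqrt_nonneg _
  have hcD : c ^ 2 < D ^ 2 := by linarith
  obtain ⟨hcD₁, hcD₂⟩ := abs_lt.mp (abs_lt_of_sq_lt_sq hcD hD0)
  have hq0 : q ≠ 0 := hq.ne
  have h₁ := h ((-c + D) / (2 * q)) (le_of_eq (by field_simp; linear_combination -hDsq))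
  have h₂ := h ((-c - D) / (2 * q)) (le_of_eq (by field_simp; linear_combination -hDsq))
  have key : (D + c) * (r + (-c + D) / (2 * q) * d + ((-c + D) / (2 * q)) ^ 2 * s)
      + (D - c) * (r + (-c - D) / (2 * q) * d + ((-c - D) / (2 * q)) ^ 2 * s)
      = 2 * D * (r - s * p / q) := by
    field_simp
    linear_combination (2 * D * s) * hDsq
  have hsum : 0 ≤ 2 * D * (r - s * p / q) := by
    rw [← key]
    exact add_nonneg (mul_nonneg (by linarith) h₁) (mul_nonneg (by linarith) h₂)
  have hr : s * p / q ≤ r := sub_nonneg.mp (nonneg_of_mul_nonneg_right hsum (by linarith))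
  exact (div_le_iff_of_neg hq).mp hr

/-- The quadratic form of a matrix along the line `x + t y`. -/
theorem add_smul_dotProduct_mulVec {ι R : Type*} [Fintype ι] [CommRing R] (M : Matrix ι ι R)
    (x y : ι → R) (t : R) :
    (x + t • y) ⬝ᵥ M *ᵥ (x + t • y)
      = x ⬝ᵥ M *ᵥ x + t * (x ⬝ᵥ M *ᵥ y + y ⬝ᵥ M *ᵥ x) + t ^ 2 * (y ⬝ᵥ M *ᵥ y) := by
  simp only [mulVec_add, mulVec_smul, add_dotProduct, dotProduct_add, smul_dotProduct,
    dotProduct_smul, smul_eq_mul]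
  ring

theorem stmt18 (n : ℕ) (A B : Matrix (Fin n) (Fin n) ℝ) (hA : Aᵀ = A) (hB : Bᵀ = B)
    (x₀ : Fin n → ℝ) (hx₀ : 0 < x₀ ⬝ᵥ A.mulVec x₀)
    (h : ∀ x : Fin n → ℝ, 0 ≤ x ⬝ᵥ A.mulVec x → 0 ≤ x ⬝ᵥ B.mulVec x) :
    ∃ μ : ℝ, 0 ≤ μ ∧ (B - μ • A).PosSemidef := by
  let ratio (x : {x : Fin n → ℝ // 0 < x ⬝ᵥ A *ᵥ x}) : ℝ :=
    (x.1 ⬝ᵥ B *ᵥ x.1) / (x.1 ⬝ᵥ A *ᵥ x.1)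
  have : Nonempty {x : Fin n → ℝ // 0 < x ⬝ᵥ A *ᵥ x} := ⟨⟨x₀, hx₀⟩⟩
  have ratio_nonneg (x) : 0 ≤ ratio x := div_nonneg (h _ x.2.le) x.2.le
  have hbdd : BddBelow (Set.range ratio) := ⟨0, Set.forall_mem_range.mpr ratio_nonneg⟩
  refine ⟨⨅ x, ratio x, le_ciInf ratio_nonneg, .of_dotProduct_mulVec_nonneg ?_ fun y ↦ ?_⟩
  · rw [IsHermitian, conjTranspose_eq_transpose_of_trivial, transpose_sub, transpose_smul, hA, hB]
  rw [star_trivial, sub_mulVec, smul_mulVec, dotProduct_sub, dotProduct_smul, smul_eq_mul,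
    sub_nonneg]
  rcases lt_trichotomy (y ⬝ᵥ A *ᵥ y) 0 with hy | hy | hy
  · rw [← div_le_iff_of_neg hy]
    refine le_ciInf fun ⟨x, hx⟩ ↦ ?_
    have hxy := mul_le_mul_of_quadratic_nonneg_imp hx hy fun t ht ↦ by
      rw [← add_smul_dotProduct_mulVec] at ht
      exact add_smul_dotProduct_mulVec B x y t ▸ h _ ht
    rw [div_le_iff_of_neg hy, div_mul_eq_mul_div, div_le_iff₀ hx]
    exact hxy
  · rw [hy, mul_zero]
    exact h y hy.ge
  · exact (le_div_iff₀ hy).mp (ciInf_le hbdd ⟨y, hy⟩)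
end
end

section
/- Let n > 1, let L be the second order cone in ℝ^n, and let J = diag(1,−1,…,−1). For every symmetric matrix C ∈ ℝ^{n×n}, the infimum of ⟨C,X⟩ = tr(CX) over {X ∈ K_L : tr(JX) = 0} equals the infimum of ⟨C,X⟩ over {X symmetric positive semidefinite : tr(JX) = 0}, where K_L is the set of finite sums Σᵢ uᵢuᵢᵀ with all uᵢ ∈ L. -/
open Matrix

noncomputable section

/-- A pair of vectors on which a quadratic form takes opposite signs can be rotated, keeping the
sum of the two rank-one matrices, so that the form vanishes on the first vector. -/
lemma exists_vecMulVec_add_eq_of_pos_of_neg {ι : Type*} [Fintype ι] (A : Matrix ι ι ℝ)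
    {a b : ι → ℝ} (ha : 0 < (A * vecMulVec a a).trace) (hb : (A * vecMulVec b b).trace < 0) :
    ∃ v w : ι → ℝ, (A * vecMulVec v v).trace = 0 ∧
      vecMulVec v v + vecMulVec w w = vecMulVec a a + vecMulVec b b := by
  let f : ℝ → ℝ := fun θ =>
    (A * vecMulVec (Real.cos θ • a + Real.sin θ • b) (Real.cos θ • a + Real.sin θ • b)).trace
  have hf : Continuous f := by
    simp only [f, Matrix.trace, Matrix.diag, Matrix.mul_apply, vecMulVec_apply, Pi.add_apply,
      Pi.smul_apply, smul_eq_mul]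
    fun_prop
  obtain ⟨θ, -, hθ⟩ := intermediate_value_Icc' Real.pi_div_two_pos.le hf.continuousOn
    (show (0 : ℝ) ∈ Set.Icc (f (Real.pi / 2)) (f 0) by
      simp only [f, Real.cos_pi_div_two, Real.sin_pi_div_two, Real.cos_zero, Real.sin_zero,
        zero_smul, one_smul, zero_add, add_zero]
      exact ⟨hb.le, ha.le⟩)
  refine ⟨Real.cos θ • a + Real.sin θ • b, Real.cos θ • b - Real.sin θ • a, hθ, ?_⟩
  ext i j
  simp only [Matrix.add_apply, vecMulVec_apply, Pi.add_apply, Pi.sub_apply, Pi.smul_apply,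
    smul_eq_mul]
  linear_combination (a i * a j + b i * b j) * Real.sin_sq_add_cos_sq θ

/-- The Sturm–Zhang rank-one decomposition: a sum of rank-one matrices `vvᵀ` orthogonal to `A` is
a sum of rank-one matrices each of which is orthogonal to `A`. -/
lemma sum_vecMulVec_mem_closure {ι : Type*} [Fintype ι] (A : Matrix ι ι ℝ)
    (s : Multiset (ι → ℝ)) (hs : (A * (s.map fun v => vecMulVec v v).sum).trace = 0) :
    (s.map fun v => vecMulVec v v).sum ∈
      AddSubmonoid.closure {X | ∃ v, X = vecMulVec v v ∧ (A * X).trace = 0} := by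
  induction hk : s.card using Nat.strong_induction_on generalizing s with
  | _ k ih =>
  have hsum : (s.map fun v => (A * vecMulVec v v).trace).sum = 0 := by
    rw [← hs]
    simpa [Multiset.map_map, Function.comp_def] using
      (map_multiset_sum ((Matrix.traceAddMonoidHom ι ℝ).comp (AddMonoidHom.mulLeft A))
        (s.map fun v => vecMulVec v v)).symm
  by_cases hnull : ∀ v ∈ s, (A * vecMulVec v v).trace = 0
  · refine AddSubmonoid.multiset_sum_mem _ _ fun X hX => ?_
    obtain ⟨v, hv, rfl⟩ := Multiset.mem_map.1 hX
    exact AddSubmonoid.subset_closure ⟨v, rfl, hnull v hv⟩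
  have hpos : ∃ a ∈ s, 0 < (A * vecMulVec a a).trace := by
    by_contra! h
    refine hnull fun v hv => ?_
    obtain ⟨t, rfl⟩ := Multiset.exists_cons_of_mem hv
    have ht : (t.map fun v => (A * vecMulVec v v).trace).sum ≤ 0 := by
      refine (Multiset.sum_le_card_nsmul _ 0 fun x hx => ?_).trans_eq (nsmul_zero _)
      obtain ⟨w, hw, rfl⟩ := Multiset.mem_map.1 hx
      exact h w (Multiset.mem_cons_of_mem hw)
    rw [Multiset.map_cons, Multiset.sum_cons] at hsum
    linarith [h v hv]
  obtain ⟨a, has, ha⟩ := hpos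
  obtain ⟨t, rfl⟩ := Multiset.exists_cons_of_mem has
  have hneg : ∃ b ∈ t, (A * vecMulVec b b).trace < 0 := by
    by_contra! h
    have ht : 0 ≤ (t.map fun v => (A * vecMulVec v v).trace).sum := by
      refine Multiset.sum_nonneg fun x hx => ?_
      obtain ⟨w, hw, rfl⟩ := Multiset.mem_map.1 hx
      exact h w hw
    rw [Multiset.map_cons, Multiset.sum_cons] at hsum
    linarith
  obtain ⟨b, hbt, hb⟩ := hneg
  obtain ⟨r, rfl⟩ := Multiset.exists_cons_of_mem hbt
  obtain ⟨v, w, hv, hvw⟩ := exists_vecMulVec_add_eq_of_pos_of_neg A ha hb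
  have heq : ((a ::ₘ b ::ₘ r).map fun v => vecMulVec v v).sum =
      vecMulVec v v + ((w ::ₘ r).map fun v => vecMulVec v v).sum := by
    simp only [Multiset.map_cons, Multiset.sum_cons, ← add_assoc, hvw]
  rw [heq, mul_add, Matrix.trace_add, hv, zero_add] at hs
  rw [heq]
  refine add_mem (AddSubmonoid.subset_closure ⟨v, rfl, hv⟩) (ih _ ?_ (w ::ₘ r) hs rfl)
  simp [← hk]

lemma trace_Jmat_mul_vecMulVec {n : ℕ} [NeZero n] (v : Fin n → ℝ) :
    (Jmat n * vecMulVec v v).trace = v 0 ^ 2 - ∑ i, if i = 0 then 0 else v i ^ 2 := by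
  have h : ∀ i : Fin n, (if i = 0 then (1 : ℝ) else -1) * (v i * v i) =
      (if i = 0 then v i ^ 2 else 0) - if i = 0 then 0 else v i ^ 2 := by
    intro i
    split_ifs <;> ring
  simp [Jmat, Matrix.trace, Matrix.diagonal_mul, vecMulVec_apply, h, -ite_mul]

lemma mem_soc_or_neg_mem_soc {n : ℕ} [NeZero n] {v : Fin n → ℝ}
    (hv : (Jmat n * vecMulVec v v).trace = 0) : v ∈ soc n ∨ -v ∈ soc n := by
  rw [trace_Jmat_mul_vecMulVec, sub_eq_zero] at hv
  simp only [soc, Set.mem_ofPred_eq, Pi.neg_apply, neg_sq, ← hv, Real.sqrt_sq_eq_abs]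
  rcases le_total 0 (v 0) with h | h
  · exact Or.inl (abs_of_nonneg h).le
  · exact Or.inr (abs_of_nonpos h).le

lemma vecMulVec_mem_cpCone {n : ℕ} {K : Set (Fin n → ℝ)} {v : Fin n → ℝ} (hv : v ∈ K) :
    vecMulVec v v ∈ cpCone K :=
  ⟨1, fun _ => v, fun _ => hv, by simp⟩

lemma zero_mem_cpCone {n : ℕ} (K : Set (Fin n → ℝ)) : 0 ∈ cpCone K :=
  ⟨0, Fin.elim0, fun i => i.elim0, by simp⟩

lemma add_mem_cpCone {n : ℕ} {K : Set (Fin n → ℝ)} {X Y : Matrix (Fin n) (Fin n) ℝ}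
    (hX : X ∈ cpCone K) (hY : Y ∈ cpCone K) : X + Y ∈ cpCone K := by
  obtain ⟨k, u, hu, rfl⟩ := hX
  obtain ⟨l, w, hw, rfl⟩ := hY
  exact ⟨k + l, Fin.append u w, Fin.addCases (by simpa using hu) (by simpa using hw),
    by simp [Fin.sum_univ_add]⟩

lemma posSemidef_of_mem_cpCone {n : ℕ} {K : Set (Fin n → ℝ)} {X : Matrix (Fin n) (Fin n) ℝ}
    (hX : X ∈ cpCone K) : X.PosSemidef := by
  obtain ⟨m, u, -, rfl⟩ := hX
  exact Matrix.posSemidef_sum _ fun i _ => by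
    simpa using Matrix.posSemidef_vecMulVec_self_star (u i)

lemma mem_cpCone_soc_iff_posSemidef {n : ℕ} [NeZero n] {X : Matrix (Fin n) (Fin n) ℝ}
    (hJ : (Jmat n * X).trace = 0) : X ∈ cpCone (soc n) ↔ X.PosSemidef := by
  refine ⟨posSemidef_of_mem_cpCone, fun hX => ?_⟩
  obtain ⟨m, u, rfl⟩ := Matrix.posSemidef_iff_eq_sum_vecMulVec.1 hX
  have hsum : ((Finset.univ.val.map u).map fun v => vecMulVec v v).sum =
      ∑ i, vecMulVec (u i) (star (u i)) := by
    rw [Multiset.map_map]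
    simp only [star_trivial]
    rfl
  rw [← hsum] at hJ ⊢
  refine AddSubmonoid.closure_induction ?_ (zero_mem_cpCone _)
    (fun _ _ _ _ => add_mem_cpCone) (sum_vecMulVec_mem_closure (Jmat n) _ hJ)
  rintro _ ⟨v, rfl, hv⟩
  rcases mem_soc_or_neg_mem_soc hv with h | h
  · exact vecMulVec_mem_cpCone h
  · simpa [neg_vecMulVec, vecMulVec_neg] using vecMulVec_mem_cpCone h

theorem stmt19 (n : ℕ) [NeZero n] (hn : 1 < n) (C : Matrix (Fin n) (Fin n) ℝ)
    (hC : Cᵀ = C) :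
    sInf ((fun X : Matrix (Fin n) (Fin n) ℝ => ((Cᵀ * X).trace : EReal)) ''
        {X | X ∈ cpCone (soc n) ∧ (Jmat n * X).trace = 0}) =
      sInf ((fun X : Matrix (Fin n) (Fin n) ℝ => ((Cᵀ * X).trace : EReal)) ''
        {X | X.PosSemidef ∧ (Jmat n * X).trace = 0}) := by
  congr 2
  ext X
  exact and_congr_left mem_cpCone_soc_iff_posSemidef
end
end
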